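/- arXiv:1803.03896 — 2 statements merged into one kernel-verified Lean document; each statement's English description precedes it below -/
import Mathlib

section
/- Let F : [0,1] → [0,1] be continuously differentiable with F(0)=0, F(1)=1 and 0 < c_F ≤ F'(t) ≤ C_F for all t. Let t_1,…,t_N ∈ [0,1], let F_N(t) = (1/N)·#{i : t_i ≤ t} be their empirical distribution, and let D*_N = sup_{t∈[0,1]} |F_N(t) − F(t)| be the star discrepancy. Let g : [0,1] → ℝ be bounded and of bounded variation with total variation ‖g‖_TV and sup norm ‖g‖_∞, and let weights w_1,…,w_N satisfy |w_i − 1| ≤ C·D*_N for all i, for some constant C ≥ 0. Then |∫_0^1 g(t) dF(t) − (1/N)·Σ_{i=1}^N g(t_i) w_i| ≤ [‖g‖_TV + C·‖g‖_∞]·D*_N. -/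
open MeasureTheory intervalIntegral

open Set Filter Topology in
/-- If the distribution functions of two probability measures differ by at most `D`, so do their values
on every lower set. -/
theorem abs_measureReal_sub_le_of_isLowerSet {μ ν : Measure ℝ} [IsProbabilityMeasure μ]
    [IsProbabilityMeasure ν] {D : ℝ} (h : ∀ x, |μ.real (Iic x) - ν.real (Iic x)| ≤ D)
    {S : Set ℝ} (hS : IsLowerSet S) : |μ.real S - ν.real S| ≤ D := by
  have hD : 0 ≤ D := (abs_nonneg _).trans (h 0)
  have hIio (a : ℝ) : |μ.real (Iio a) - ν.real (Iio a)| ≤ D := by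
    obtain ⟨u, hu, hlt, hlim⟩ := exists_seq_strictMono_tendsto a
    have hmono : Monotone fun n => Iic (u n) := fun _ _ hnm => Iic_subset_Iic.2 (hu.monotone hnm)
    have key (ρ : Measure ℝ) [IsProbabilityMeasure ρ] :
        Tendsto (fun n => ρ.real (Iic (u n))) atTop (𝓝 (ρ.real (Iio a))) := by
      rw [← iUnion_Iic_eq_Iio_of_lt_of_tendsto hlt hlim]
      exact (ENNReal.tendsto_toReal (measure_ne_top _ _)).comp (tendsto_measure_iUnion_atTop hmono)
    exact le_of_tendsto ((key μ).sub (key ν)).abs (Eventually.of_forall fun n => h (u n))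
  rcases S.eq_empty_or_nonempty with rfl | hne
  · simpa using hD
  by_cases hb : BddAbove S
  · by_cases hmem : sSup S ∈ S
    · have : S = Iic (sSup S) :=
        Subset.antisymm (fun x hx => le_csSup hb hx) fun x hx => hS hx hmem
      rw [this]
      exact h _
    · have : S = Iio (sSup S) := by
        refine Subset.antisymm (fun x hx => lt_of_le_of_ne (le_csSup hb hx) ?_) fun x hx => ?_
        · rintro rfl
          exact hmem hx
        · obtain ⟨y, hy, hxy⟩ := exists_lt_of_lt_csSup hne hx
          exact hS hxy.le hy
      rw [this]
      exact hIio _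
  · have : S = univ := by
      refine eq_univ_of_forall fun x => ?_
      obtain ⟨y, hy, hxy⟩ := not_bddAbove_iff.1 hb x
      exact hS hxy.le hy
    simpa [this] using hD

open Set in
/-- Koksma's inequality for a monotone integrand with values in `[m, M]`. -/
theorem abs_integral_sub_integral_le_of_monotone {μ ν : Measure ℝ} [IsProbabilityMeasure μ]
    [IsProbabilityMeasure ν] {D : ℝ} (h : ∀ x, |μ.real (Iic x) - ν.real (Iic x)| ≤ D)
    {p : ℝ → ℝ} (hp : Monotone p) {m M : ℝ} (hm : ∀ x, m ≤ p x) (hM : ∀ x, p x ≤ M) :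
    |∫ x, p x ∂μ - ∫ x, p x ∂ν| ≤ (M - m) * D := by
  have hint (ρ : Measure ℝ) [IsProbabilityMeasure ρ] : Integrable p ρ :=
    .of_mem_Icc m M hp.measurable.aemeasurable (ae_of_all _ fun x => ⟨hm x, hM x⟩)
  have layer (ρ : Measure ℝ) [IsProbabilityMeasure ρ] :
      ∫ x, p x ∂ρ = m + ∫ s in Ioc 0 (M - m), ρ.real {x | s ≤ p x - m} := by
    have hlayer := Integrable.integral_eq_integral_Ioc_meas_le (f := fun x => p x - m)
      ((hint ρ).sub (integrable_const m)) (ae_of_all _ fun x => sub_nonneg.2 (hm x))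
      (ae_of_all _ fun x => sub_le_sub_right (hM x) m)
    rw [← hlayer, integral_sub (hint ρ) (integrable_const m)]
    simp
  have hlevel (ρ : Measure ℝ) [IsProbabilityMeasure ρ] :
      IntegrableOn (fun s => ρ.real {x | s ≤ p x - m}) (Ioc 0 (M - m)) := by
    have hanti : Antitone fun s => ρ.real {x | s ≤ p x - m} :=
      fun s t hst => measureReal_mono fun x hx => hst.trans hx
    exact (hanti.antitoneOn _).integrableOn_isCompact isCompact_Icc |>.mono_set Ioc_subset_Icc_self
  have hdiff (s : ℝ) : |μ.real {x | s ≤ p x - m} - ν.real {x | s ≤ p x - m}| ≤ D := by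
    have hmeas : MeasurableSet {x | s ≤ p x - m} :=
      measurableSet_le measurable_const (hp.measurable.sub_const m)
    have hlow : IsLowerSet {x | s ≤ p x - m}ᶜ := by
      intro x y hyx hx
      simp only [mem_compl_iff, mem_ofPred_eq, not_le] at hx ⊢
      linarith [hp hyx]
    have := abs_measureReal_sub_le_of_isLowerSet h hlow
    rwa [probReal_compl_eq_one_sub hmeas, probReal_compl_eq_one_sub hmeas, sub_sub_sub_cancel_left,
      abs_sub_comm] at this
  rw [layer μ, layer ν, add_sub_add_left_eq_sub, ← integral_sub (hlevel μ) (hlevel ν)]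
  have hmM : m ≤ M := (hm 0).trans (hM 0)
  have hbound := norm_setIntegral_le_of_norm_le_const (μ := volume) (s := Ioc 0 (M - m))
    (f := fun s => μ.real {x | s ≤ p x - m} - ν.real {x | s ≤ p x - m}) (by simp)
    fun s _ => hdiff s
  refine hbound.trans_eq ?_
  simp [hmM, mul_comm]

open Set in
/-- Koksma's inequality for two probability measures supported on `[a, b]`. -/
theorem abs_integral_sub_integral_le_eVariationOn_mul {μ ν : Measure ℝ} [IsProbabilityMeasure μ]
    [IsProbabilityMeasure ν] {a b : ℝ} (hab : a ≤ b) (hμ : μ (Icc a b)ᶜ = 0) (hν : ν (Icc a b)ᶜ = 0)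
    {D : ℝ} (h : ∀ x ∈ Icc a b, |μ.real (Iic x) - ν.real (Iic x)| ≤ D)
    {g : ℝ → ℝ} (hg : BoundedVariationOn g (Icc a b)) :
    |∫ x, g x ∂μ - ∫ x, g x ∂ν| ≤ (eVariationOn g (Icc a b)).toReal * D := by
  have ha : a ∈ Icc a b := left_mem_Icc.2 hab
  have hb : b ∈ Icc a b := right_mem_Icc.2 hab
  have h' (x : ℝ) : |μ.real (Iic x) - ν.real (Iic x)| ≤ D := by
    by_cases hxa : x < a
    · have hzero {ρ : Measure ℝ} (hρ : ρ (Icc a b)ᶜ = 0) : ρ.real (Iic x) = 0 := by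
        rw [measureReal_def, measure_mono_null _ hρ, ENNReal.toReal_zero]
        exact fun y (hy : y ≤ x) hy' => (hy.trans_lt hxa).not_ge hy'.1
      rw [hzero hμ, hzero hν, sub_zero, abs_zero]
      exact (abs_nonneg _).trans (h a ha)
    by_cases hxb : x ≤ b
    · exact h x ⟨not_lt.1 hxa, hxb⟩
    · have heq {ρ : Measure ℝ} (hρ : ρ (Icc a b)ᶜ = 0) : ρ.real (Iic x) = ρ.real (Iic b) := by
        refine measureReal_congr ?_
        filter_upwards [mem_ae_iff.2 hρ] with y hy
        exact propext ⟨fun _ => hy.2, fun _ => hy.2.trans (not_le.1 hxb).le⟩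
      rw [heq hμ, heq hν]
      exact h b hb
  have hloc := hg.locallyBoundedVariationOn
  set V := variationOnFromTo g (Icc a b) a with hV
  set P : ℝ → ℝ := fun x => (V x + g x) / 2 with hP
  set Q : ℝ → ℝ := fun x => (V x - g x) / 2 with hQ
  have hPmono : MonotoneOn P (Icc a b) := fun x hx y hy hxy =>
    div_le_div_of_nonneg_right (variationOnFromTo.add_self_monotoneOn hloc ha hx hy hxy) two_pos.le
  have hQmono : MonotoneOn Q (Icc a b) := fun x hx y hy hxy =>
    div_le_div_of_nonneg_right (variationOnFromTo.sub_self_monotoneOn hloc ha hx hy hxy) two_pos.le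
  let π : ℝ → ℝ := fun x => projIcc a b hab x
  have hπmem (x : ℝ) : π x ∈ Icc a b := (projIcc a b hab x).2
  have hπmono : Monotone π := fun x y hxy => monotone_projIcc hab hxy
  have hmono {f : ℝ → ℝ} (hf : MonotoneOn f (Icc a b)) : Monotone (f ∘ π) :=
    fun x y hxy => hf (hπmem x) (hπmem y) (hπmono hxy)
  have hlow {f : ℝ → ℝ} (hf : MonotoneOn f (Icc a b)) (x : ℝ) : f a ≤ (f ∘ π) x :=
    hf ha (hπmem x) (hπmem x).1
  have hupp {f : ℝ → ℝ} (hf : MonotoneOn f (Icc a b)) (x : ℝ) : (f ∘ π) x ≤ f b :=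
    hf (hπmem x) hb (hπmem x).2
  have hsplit {ρ : Measure ℝ} [IsProbabilityMeasure ρ] (hρ : ρ (Icc a b)ᶜ = 0) :
      ∫ x, g x ∂ρ = ∫ x, (P ∘ π) x ∂ρ - ∫ x, (Q ∘ π) x ∂ρ := by
    have hint {f : ℝ → ℝ} (hf : MonotoneOn f (Icc a b)) : Integrable (f ∘ π) ρ :=
      .of_mem_Icc (f a) (f b) (hmono hf).measurable.aemeasurable
        (ae_of_all _ fun x => ⟨hlow hf x, hupp hf x⟩)
    rw [← integral_sub (hint hPmono) (hint hQmono)]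
    refine integral_congr_ae ?_
    filter_upwards [mem_ae_iff.2 hρ] with x hx
    have : π x = x := congrArg Subtype.val (projIcc_of_mem hab hx)
    simp only [Function.comp_apply, this, hP, hQ]
    ring
  have hPbound := abs_integral_sub_integral_le_of_monotone h' (hmono hPmono) (hlow hPmono)
    (hupp hPmono)
  have hQbound := abs_integral_sub_integral_le_of_monotone h' (hmono hQmono) (hlow hQmono)
    (hupp hQmono)
  have hVa : V a = 0 := variationOnFromTo.self _ _ _
  have hVb : V b = (eVariationOn g (Icc a b)).toReal := by
    rw [hV, variationOnFromTo.eq_of_le _ _ hab, inter_self]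
  rw [hsplit hμ, hsplit hν, sub_sub_sub_comm]
  refine (abs_sub _ _).trans ((add_le_add hPbound hQbound).trans_eq ?_)
  rw [← add_mul, ← hVb]
  simp only [hP, hQ, hVa]
  ring

/-- Generalized Koksma inequality.
`F : [0,1] → [0,1]` is `C¹` with derivative `F'` satisfying `0 < c_F ≤ F' ≤ C_F`,
`F(0) = 0`, `F(1) = 1`.  `FN` is the empirical distribution of points `t_1,…,t_N ∈ [0,1]`
and `D` is their star discrepancy `sup_{t∈[0,1]} |FN(t) − F(t)|`.  `g` is bounded and of
bounded variation on `[0,1]` with sup norm `gsup`, and the weights satisfy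
`|w_i − 1| ≤ C·D`.  Then the Riemann–Stieltjes integral `∫_0^1 g dF = ∫_0^1 g(t)F'(t)dt`
differs from the weighted discrete sum by at most `(‖g‖_TV + C·‖g‖_∞)·D`. -/
theorem generalized_koksma
    (F F' : ℝ → ℝ) (cF CF : ℝ)
    (hF0 : F 0 = 0) (hF1 : F 1 = 1)
    (hFmaps : ∀ t ∈ Set.Icc (0 : ℝ) 1, F t ∈ Set.Icc (0 : ℝ) 1)
    (hFderiv : ∀ t ∈ Set.Icc (0 : ℝ) 1, HasDerivWithinAt F (F' t) (Set.Icc 0 1) t)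
    (hF'cont : ContinuousOn F' (Set.Icc 0 1))
    (hcF : 0 < cF)
    (hF'bnd : ∀ t ∈ Set.Icc (0 : ℝ) 1, cF ≤ F' t ∧ F' t ≤ CF)
    (N : ℕ) (hN : 0 < N)
    (t : Fin N → ℝ) (ht : ∀ i, t i ∈ Set.Icc (0 : ℝ) 1)
    (FN : ℝ → ℝ)
    (hFN : ∀ x, FN x = (Finset.univ.filter (fun i => t i ≤ x)).card / (N : ℝ))
    (D : ℝ)
    (hD : IsLUB {d : ℝ | ∃ x ∈ Set.Icc (0 : ℝ) 1, d = |FN x - F x|} D)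
    (g : ℝ → ℝ)
    (hgBV : BoundedVariationOn g (Set.Icc 0 1))
    (gsup : ℝ)
    (hgsup : IsLUB {y : ℝ | ∃ x ∈ Set.Icc (0 : ℝ) 1, y = |g x|} gsup)
    (C : ℝ) (hC : 0 ≤ C)
    (w : Fin N → ℝ) (hw : ∀ i, |w i - 1| ≤ C * D) :
    |(∫ x in (0:ℝ)..1, g x * F' x) - (1 / (N : ℝ)) * ∑ i, g (t i) * w i|
      ≤ ((eVariationOn g (Set.Icc 0 1)).toReal + C * gsup) * D := by
  have hNR : (0 : ℝ) < N := Nat.cast_pos.2 hN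
  have hN0 : (N : ENNReal) ≠ 0 := Nat.cast_ne_zero.2 hN.ne'
  have hF'nn : ∀ x ∈ Set.Icc (0 : ℝ) 1, 0 ≤ F' x := fun x hx => hcF.le.trans (hF'bnd x hx).1
  have hF'int : IntegrableOn F' (Set.Icc 0 1) := hF'cont.integrableOn_compact isCompact_Icc
  set μ : Measure ℝ := (volume.restrict (Set.Icc 0 1)).withDensity fun x => ENNReal.ofReal (F' x)
    with hμdef
  set ν : Measure ℝ := (N : ENNReal)⁻¹ • ∑ i, Measure.dirac (t i) with hνdef
  have hμcdf : ∀ x ∈ Set.Icc (0 : ℝ) 1, μ (Set.Iic x) = ENNReal.ofReal (F x) := by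
    intro x hx
    have hsub : Set.Icc 0 x ⊆ Set.Icc (0 : ℝ) 1 := Set.Icc_subset_Icc_right hx.2
    have hinter : Set.Iic x ∩ Set.Icc 0 1 = Set.Icc 0 x := by
      ext y
      simp only [Set.mem_inter_iff, Set.mem_Iic, Set.mem_Icc]
      exact ⟨fun h => ⟨h.2.1, h.1⟩, fun h => ⟨h.2, h.1, h.2.trans hx.2⟩⟩
    rw [withDensity_apply _ measurableSet_Iic, Measure.restrict_restrict measurableSet_Iic, hinter,
      ← ofReal_integral_eq_lintegral_ofReal (hF'int.mono_set hsub)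
        (ae_restrict_of_forall_mem measurableSet_Icc fun y hy => hF'nn y (hsub hy)),
      integral_Icc_eq_integral_Ioc, ← intervalIntegral.integral_of_le hx.1,
      integral_eq_sub_of_hasDerivAt_of_le hx.1
        (fun y hy => ((hFderiv y (hsub hy)).continuousWithinAt).mono hsub)
        (fun y hy => (hFderiv y (hsub (Set.Ioo_subset_Icc_self hy))).hasDerivAt
          (Icc_mem_nhds hy.1 (hy.2.trans_le hx.2)))
        ((intervalIntegrable_iff_integrableOn_Icc_of_le hx.1).2 (hF'int.mono_set hsub)),
      hF0, sub_zero]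
  have hμsupp : μ (Set.Icc 0 1)ᶜ = 0 :=
    withDensity_absolutelyContinuous _ _ (by simp [measurableSet_Icc])
  have hνapply {s : Set ℝ} (hs : MeasurableSet s) :
      ν s = (N : ENNReal)⁻¹ * ∑ i, s.indicator 1 (t i) := by
    simp [hνdef, Measure.dirac_apply' _ hs]
  have hνsupp : ν (Set.Icc 0 1)ᶜ = 0 := by
    rw [hνapply measurableSet_Icc.compl]
    simp [Finset.sum_eq_zero, ht]
  have : IsProbabilityMeasure μ := by
    constructor
    have huniv : (Set.univ : Set ℝ) =ᵐ[μ] Set.Iic 1 := by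
      filter_upwards [mem_ae_iff.2 hμsupp] with y hy
      exact propext ⟨fun _ => hy.2, fun _ => trivial⟩
    rw [measure_congr huniv, hμcdf 1 (by simp), hF1, ENNReal.ofReal_one]
  have : IsProbabilityMeasure ν := by
    constructor
    rw [hνapply .univ]
    simp [ENNReal.inv_mul_cancel hN0]
  have hcdf : ∀ x ∈ Set.Icc (0 : ℝ) 1, |μ.real (Set.Iic x) - ν.real (Set.Iic x)| ≤ D := by
    intro x hx
    have hμx : μ.real (Set.Iic x) = F x := by
      rw [measureReal_def, hμcdf x hx, ENNReal.toReal_ofReal (hFmaps x hx).1]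
    have hνx : ν.real (Set.Iic x) = FN x := by
      rw [measureReal_def, hνapply measurableSet_Iic, hFN]
      simp [Set.indicator_apply, div_eq_inv_mul]
    rw [hμx, hνx, abs_sub_comm]
    exact hD.1 ⟨x, hx, rfl⟩
  have hμint : ∫ x, g x ∂μ = ∫ x in (0:ℝ)..1, g x * F' x := by
    rw [intervalIntegral.integral_of_le zero_le_one, ← integral_Icc_eq_integral_Ioc, hμdef,
      integral_withDensity_eq_integral_toReal_smul₀ hF'int.aemeasurable.ennreal_ofReal
        (ae_of_all _ fun x => ENNReal.ofReal_lt_top)]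
    refine setIntegral_congr_fun measurableSet_Icc fun x hx => ?_
    simp [ENNReal.toReal_ofReal (hF'nn x hx), mul_comm]
  have hνint : ∫ x, g x ∂ν = (1 / (N : ℝ)) * ∑ i, g (t i) := by
    rw [hνdef, MeasureTheory.integral_smul_measure,
      integral_finsetSum_measure fun i _ => integrable_dirac (by simp)]
    simp
  have hkoksma := abs_integral_sub_integral_le_eVariationOn_mul zero_le_one hμsupp hνsupp hcdf hgBV
  have hweights : |(1 / (N : ℝ)) * ∑ i, g (t i) * (w i - 1)| ≤ C * gsup * D := by
    have hgs : ∀ i, |g (t i)| ≤ gsup := fun i => hgsup.1 ⟨t i, ht i, rfl⟩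
    have hsum : |∑ i, g (t i) * (w i - 1)| ≤ N * (gsup * (C * D)) := by
      refine (Finset.abs_sum_le_sum_abs _ _).trans ?_
      calc _ ≤ ∑ _i : Fin N, gsup * (C * D) := by
            refine Finset.sum_le_sum fun i _ => ?_
            rw [abs_mul]
            exact mul_le_mul (hgs i) (hw i) (abs_nonneg _) ((abs_nonneg _).trans (hgs i))
        _ = _ := by simp
    rw [abs_mul, abs_of_pos (one_div_pos.2 hNR)]
    calc _ ≤ 1 / (N : ℝ) * (N * (gsup * (C * D))) := by gcongr
      _ = C * gsup * D := by field_simp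
  have hdecomp : (∫ x in (0:ℝ)..1, g x * F' x) - (1 / (N : ℝ)) * ∑ i, g (t i) * w i
      = (∫ x, g x ∂μ - ∫ x, g x ∂ν) - (1 / (N : ℝ)) * ∑ i, g (t i) * (w i - 1) := by
    rw [hμint, hνint]
    simp only [mul_sub, mul_one, Finset.sum_sub_distrib]
    ring
  rw [hdecomp, add_mul]
  exact (abs_sub _ _).trans (add_le_add hkoksma hweights)
end

section
/- Let T > 0 and let M : [0,T] → ℝ be continuously differentiable. Assume M has finitely many zeros, all lying in the open interval (0,T), with M'(t) ≠ 0 at every zero t of M, and assume M' has finitely many zeros in [0,T]. Let N_z^0 be the number of zeros of M in [0,T]. List the local maximum values of |M| on [0,T] (counting the endpoints 0 and T as locations of relative extrema) as M_1,…,M_{L_mx}, assigning weight ν̂_j = 1 if the maximum is attained at 0 or T and ν̂_j = 2 otherwise; list the nonzero local minimum values of |M| as m_1,…,m_{L_mn}, with weights ν_j defined the same way. Then ∫_0^T φ(M(t)) |M'(t)| dt = N_z^0 + Σ_{j=1}^{L_mn} ν_j Φ(−m_j) − Σ_{j=1}^{L_mx} ν̂_j Φ(−M_j), where φ(z) = (2π)^{−1/2}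 e^{−z²/2} and Φ(z) = ∫_{−∞}^z φ(u)du. -/
open MeasureTheory intervalIntegral

/-- The standard Gaussian density. -/
noncomputable def phi (z : ℝ) : ℝ := (Real.sqrt (2 * Real.pi))⁻¹ * Real.exp (-(z ^ 2) / 2)

/-- The standard Gaussian distribution function. -/
noncomputable def Phi (z : ℝ) : ℝ := ∫ u in Set.Iic z, phi u

open Set Filter Topology

lemma phi_eq_gaussianPDFReal : phi = ProbabilityTheory.gaussianPDFReal 0 1 := by
  ext z
  simp [phi, ProbabilityTheory.gaussianPDFReal]

lemma continuous_phi : Continuous phi := by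
  unfold phi
  fun_prop

lemma phi_neg (z : ℝ) : phi (-z) = phi z := by
  simp [phi]

lemma integrable_phi : Integrable phi := by
  rw [phi_eq_gaussianPDFReal]
  exact ProbabilityTheory.integrable_gaussianPDFReal 0 1

lemma integral_phi : ∫ z, phi z = 1 := by
  rw [phi_eq_gaussianPDFReal]
  exact ProbabilityTheory.integral_gaussianPDFReal_eq_one 0 one_ne_zero

lemma hasDerivAt_Phi (z : ℝ) : HasDerivAt Phi (phi z) z := by
  have h : Phi = fun y => Phi 0 + ∫ u in (0 : ℝ)..y, phi u := by
    ext y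
    rw [← intervalIntegral.integral_Iic_sub_Iic integrable_phi.integrableOn
      integrable_phi.integrableOn]
    simp [Phi]
  rw [h]
  exact (continuous_phi.integral_hasStrictDerivAt 0 z).hasDerivAt.const_add _

lemma Phi_neg (z : ℝ) : Phi (-z) = 1 - Phi z := by
  have h1 : Phi (-z) = ∫ u in Ioi z, phi u := by
    have := integral_comp_neg_Iic (-z) phi
    simpa [phi_neg, Phi] using this
  have h2 : Phi z + ∫ u in Ioi z, phi u = 1 := by
    rw [← integral_phi]
    exact intervalIntegral.integral_Iic_add_Ioi integrable_phi.integrableOn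
      integrable_phi.integrableOn
  linarith

lemma Phi_zero : Phi 0 = 1 / 2 := by
  have := Phi_neg 0
  rw [neg_zero] at this
  linarith

/-- Splitting an interval integral at finitely many points and collecting the boundary terms
by points. -/
lemma integral_eq_boundary_add_sum_jumps {f G l r : ℝ → ℝ} (S : Finset ℝ) {a b : ℝ} (hab : a < b)
    (hf : IntervalIntegrable f volume a b)
    (h : ∀ c d, a ≤ c → c < d → d ≤ b → (∀ x ∈ S, x ∉ Ioo c d) →
      ∫ t in c..d, f t = G c * r c - G d * l d) :
    ∫ t in a..b, f t
      = G a * r a - G b * l b + ∑ x ∈ S with x ∈ Ioo a b, G x * (r x - l x) := by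
  classical
  induction S using Finset.induction_on generalizing a b with
  | empty => simpa using h a b le_rfl hab le_rfl (by simp)
  | insert c S hc ih =>
    by_cases hcab : c ∈ Ioo a b
    · have hac : IntervalIntegrable f volume a c := hf.mono_set (by
        rw [uIcc_of_le hcab.1.le, uIcc_of_le hab.le]
        exact Icc_subset_Icc_right hcab.2.le)
      have hcb : IntervalIntegrable f volume c b := hf.mono_set (by
        rw [uIcc_of_le hcab.2.le, uIcc_of_le hab.le]
        exact Icc_subset_Icc_left hcab.1.le)
      have h1 := ih hcab.1 hac (fun p q hp hpq hq hS => h p q hp hpq (hq.trans hcab.2.le) (by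
        intro x hx
        rcases Finset.mem_insert.1 hx with rfl | hx
        · exact fun hx' => hq.not_gt hx'.2
        · exact hS x hx))
      have h2 := ih hcab.2 hcb (fun p q hp hpq hq hS => h p q (hcab.1.le.trans hp) hpq hq (by
        intro x hx
        rcases Finset.mem_insert.1 hx with rfl | hx
        · exact fun hx' => hp.not_gt hx'.1
        · exact hS x hx))
      have hsplit : S.filter (· ∈ Ioo a b)
          = S.filter (· ∈ Ioo a c) ∪ S.filter (· ∈ Ioo c b) := by
        ext x
        have hxc : x ∈ S → x ≠ c := fun hx hxc => hc (hxc ▸ hx)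
        simp only [Finset.mem_filter, Finset.mem_union, mem_Ioo]
        have := hcab.1
        have := hcab.2
        constructor
        · rintro ⟨hx, h1, h2⟩
          rcases lt_or_gt_of_ne (hxc hx) with h3 | h3
          · exact Or.inl ⟨hx, h1, h3⟩
          · exact Or.inr ⟨hx, h3, h2⟩
        · rintro (⟨hx, h1, h2⟩ | ⟨hx, h1, h2⟩)
          · exact ⟨hx, h1, by linarith⟩
          · exact ⟨hx, by linarith, h2⟩
      have hdisj : Disjoint (S.filter (· ∈ Ioo a c)) (S.filter (· ∈ Ioo c b)) := by
        rw [Finset.disjoint_filter]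
        exact fun x _ h1 h2 => lt_asymm h1.2 h2.1
      rw [← integral_add_adjacent_intervals hac hcb, h1, h2, Finset.filter_insert, if_pos hcab,
        Finset.sum_insert (by simp [hc]), hsplit, Finset.sum_union hdisj]
      ring
    · rw [Finset.filter_insert, if_neg hcab]
      refine ih hab hf (fun p q hp hpq hq hS => h p q hp hpq hq fun x hx => ?_)
      rcases Finset.mem_insert.1 hx with rfl | hx
      · exact fun hx' => hcab ⟨hp.trans_lt hx'.1, hx'.2.trans_le hq⟩
      · exact hS x hx

open Classical in
/-- `1` if `g` exceeds `g x` immediately to the right of `x`, and `-1` otherwise. -/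
noncomputable def rightSign (g : ℝ → ℝ) (x : ℝ) : ℝ :=
  if ∀ᶠ y in 𝓝[>] x, g x < g y then 1 else -1

open Classical in
/-- `1` if `g` is below `g x` immediately to the left of `x`, and `-1` otherwise. -/
noncomputable def leftSign (g : ℝ → ℝ) (x : ℝ) : ℝ :=
  if ∀ᶠ y in 𝓝[<] x, g y < g x then 1 else -1

lemma rightSign_of_lt {g : ℝ → ℝ} {x : ℝ} (h : ∀ᶠ y in 𝓝[>] x, g x < g y) :
    rightSign g x = 1 := if_pos h

lemma rightSign_of_gt {g : ℝ → ℝ} {x : ℝ} (h : ∀ᶠ y in 𝓝[>] x, g y < g x) :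
    rightSign g x = -1 := by
  refine if_neg fun h' => ?_
  obtain ⟨y, h1, h2⟩ := (h.and h').exists
  exact lt_asymm h1 h2

lemma leftSign_of_lt {g : ℝ → ℝ} {x : ℝ} (h : ∀ᶠ y in 𝓝[<] x, g y < g x) :
    leftSign g x = 1 := if_pos h

lemma leftSign_of_gt {g : ℝ → ℝ} {x : ℝ} (h : ∀ᶠ y in 𝓝[<] x, g x < g y) :
    leftSign g x = -1 := by
  refine if_neg fun h' => ?_
  obtain ⟨y, h1, h2⟩ := (h.and h').exists
  exact lt_asymm h1 h2

lemma StrictMonoOn.eventually_nhdsGT_lt {g : ℝ → ℝ} {c d : ℝ} (h : StrictMonoOn g (Icc c d))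
    (hcd : c < d) : ∀ᶠ y in 𝓝[>] c, g c < g y := by
  filter_upwards [Ioo_mem_nhdsGT hcd] with y hy
  exact h (left_mem_Icc.2 hcd.le) (Ioo_subset_Icc_self hy) hy.1

lemma StrictMonoOn.eventually_nhdsLT_lt {g : ℝ → ℝ} {c d : ℝ} (h : StrictMonoOn g (Icc c d))
    (hcd : c < d) : ∀ᶠ y in 𝓝[<] d, g y < g d := by
  filter_upwards [Ioo_mem_nhdsLT hcd] with y hy
  exact h (Ioo_subset_Icc_self hy) (right_mem_Icc.2 hcd.le) hy.2

lemma StrictAntiOn.eventually_nhdsGT_gt {g : ℝ → ℝ} {c d : ℝ} (h : StrictAntiOn g (Icc c d))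
    (hcd : c < d) : ∀ᶠ y in 𝓝[>] c, g y < g c := by
  filter_upwards [Ioo_mem_nhdsGT hcd] with y hy
  exact h (left_mem_Icc.2 hcd.le) (Ioo_subset_Icc_self hy) hy.1

lemma StrictAntiOn.eventually_nhdsLT_gt {g : ℝ → ℝ} {c d : ℝ} (h : StrictAntiOn g (Icc c d))
    (hcd : c < d) : ∀ᶠ y in 𝓝[<] d, g d < g y := by
  filter_upwards [Ioo_mem_nhdsLT hcd] with y hy
  exact h (Ioo_subset_Icc_self hy) (right_mem_Icc.2 hcd.le) hy.2

open Classical in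
/-- The jump of the slope sign at a point counts local minima positively and local maxima
negatively, once at an endpoint and twice in the interior. -/
lemma sign_jump_eq_weight {g : ℝ → ℝ} {a b x : ℝ} (hab : a < b) (hx : x ∈ Icc a b)
    (hR : x < b → (∀ᶠ y in 𝓝[>] x, g x < g y) ∨ ∀ᶠ y in 𝓝[>] x, g y < g x)
    (hL : a < x → (∀ᶠ y in 𝓝[<] x, g y < g x) ∨ ∀ᶠ y in 𝓝[<] x, g x < g y) :
    (if x = b then 0 else rightSign g x) - (if x = a then 0 else leftSign g x)
      = (if x = a ∨ x = b then (1 : ℝ) else 2) *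
        ((if IsLocalMinOn g (Icc a b) x then 1 else 0)
          - (if IsLocalMaxOn g (Icc a b) x then 1 else 0)) := by
  have hle (hxb : x < b) : 𝓝[>] x ≤ 𝓝[Icc a b] x := by
    rw [← nhdsWithin_Ioo_eq_nhdsGT hxb]
    exact nhdsWithin_mono _ fun y hy => ⟨hx.1.trans hy.1.le, hy.2.le⟩
  have hge (hax : a < x) : 𝓝[<] x ≤ 𝓝[Icc a b] x := by
    rw [← nhdsWithin_Ioo_eq_nhdsLT hax]
    exact nhdsWithin_mono _ fun y hy => ⟨hy.1.le, hy.2.le.trans hx.2⟩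
  have noMaxR (hxb : x < b) (h : ∀ᶠ y in 𝓝[>] x, g x < g y) :
      ¬ IsLocalMaxOn g (Icc a b) x := fun hm => by
    obtain ⟨y, h1, h2⟩ := (h.and (hm.filter_mono (hle hxb))).exists
    exact h1.not_ge h2
  have noMinR (hxb : x < b) (h : ∀ᶠ y in 𝓝[>] x, g y < g x) :
      ¬ IsLocalMinOn g (Icc a b) x := fun hm => by
    obtain ⟨y, h1, h2⟩ := (h.and (hm.filter_mono (hle hxb))).exists
    exact h1.not_ge h2
  have noMaxL (hax : a < x) (h : ∀ᶠ y in 𝓝[<] x, g x < g y) :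
      ¬ IsLocalMaxOn g (Icc a b) x := fun hm => by
    obtain ⟨y, h1, h2⟩ := (h.and (hm.filter_mono (hge hax))).exists
    exact h1.not_ge h2
  have noMinL (hax : a < x) (h : ∀ᶠ y in 𝓝[<] x, g y < g x) :
      ¬ IsLocalMinOn g (Icc a b) x := fun hm => by
    obtain ⟨y, h1, h2⟩ := (h.and (hm.filter_mono (hge hax))).exists
    exact h1.not_ge h2
  have glue {p : ℝ → Prop} (hp : p x) (h1 : x < b → ∀ᶠ y in 𝓝[>] x, p y)
      (h2 : a < x → ∀ᶠ y in 𝓝[<] x, p y) : ∀ᶠ y in 𝓝[Icc a b] x, p y := by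
    have e1 : ∀ᶠ y in 𝓝 x, y ∈ Ioi x → y ≤ b → p y := by
      rcases hx.2.lt_or_eq with hxb | rfl
      · filter_upwards [eventually_nhdsWithin_iff.1 (h1 hxb)] with y hy hy' _ using hy hy'
      · exact Eventually.of_forall fun y hy hy' => absurd hy' (not_le.2 hy)
    have e2 : ∀ᶠ y in 𝓝 x, y ∈ Iio x → a ≤ y → p y := by
      rcases hx.1.lt_or_eq with hax | rfl
      · filter_upwards [eventually_nhdsWithin_iff.1 (h2 hax)] with y hy hy' _ using hy hy'
      · exact Eventually.of_forall fun y hy hy' => absurd hy' (not_le.2 hy)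
    rw [eventually_nhdsWithin_iff]
    filter_upwards [e1, e2] with y h1 h2 hy
    rcases lt_trichotomy y x with h | rfl | h
    · exact h2 h hy.1
    · exact hp
    · exact h1 h hy.2
  have isMin (h1 : x < b → ∀ᶠ y in 𝓝[>] x, g x < g y) (h2 : a < x → ∀ᶠ y in 𝓝[<] x, g x < g y) :
      IsLocalMinOn g (Icc a b) x :=
    glue le_rfl (fun h => (h1 h).mono fun _ => le_of_lt) (fun h => (h2 h).mono fun _ => le_of_lt)
  have isMax (h1 : x < b → ∀ᶠ y in 𝓝[>] x, g y < g x) (h2 : a < x → ∀ᶠ y in 𝓝[<] x, g y < g x) :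
      IsLocalMaxOn g (Icc a b) x :=
    glue le_rfl (fun h => (h1 h).mono fun _ => le_of_lt) (fun h => (h2 h).mono fun _ => le_of_lt)
  rcases hx.1.eq_or_lt with hxa | hax
  · subst hxa
    rw [if_neg hab.ne, if_pos rfl, if_pos (Or.inl rfl)]
    rcases hR hab with h | h
    · rw [rightSign_of_lt h, if_neg (noMaxR hab h),
        if_pos (isMin (fun _ => h) fun h => absurd h (lt_irrefl _))]
      norm_num
    · rw [rightSign_of_gt h, if_neg (noMinR hab h),
        if_pos (isMax (fun _ => h) fun h => absurd h (lt_irrefl _))]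
      norm_num
  rcases hx.2.eq_or_lt with hxb | hxb
  · subst hxb
    rw [if_neg hab.ne', if_pos rfl, if_pos (Or.inr rfl)]
    rcases hL hab with h | h
    · rw [leftSign_of_lt h, if_neg (noMinL hab h),
        if_pos (isMax (fun h => absurd h (lt_irrefl _)) fun _ => h)]
      norm_num
    · rw [leftSign_of_gt h, if_neg (noMaxL hab h),
        if_pos (isMin (fun h => absurd h (lt_irrefl _)) fun _ => h)]
      norm_num
  rw [if_neg hxb.ne, if_neg hax.ne', if_neg (not_or.2 ⟨hax.ne', hxb.ne⟩)]
  rcases hR hxb with h | h <;> rcases hL hax with h' | h'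
  · simp [rightSign_of_lt h, leftSign_of_lt h', noMaxR hxb h, noMinL hax h']
  · rw [rightSign_of_lt h, leftSign_of_gt h', if_neg (noMaxR hxb h),
      if_pos (isMin (fun _ => h) fun _ => h')]
    norm_num
  · rw [rightSign_of_gt h, leftSign_of_lt h', if_neg (noMinR hxb h),
      if_pos (isMax (fun _ => h) fun _ => h')]
    norm_num
  · simp [rightSign_of_gt h, leftSign_of_gt h', noMinR hxb h, noMaxL hax h']

lemma ContinuousOn.forall_pos_or_forall_neg_Ioo {f : ℝ → ℝ} {c d : ℝ}
    (hf : ContinuousOn f (Ioo c d)) (h0 : ∀ x ∈ Ioo c d, f x ≠ 0) :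
    (∀ x ∈ Ioo c d, 0 < f x) ∨ ∀ x ∈ Ioo c d, f x < 0 := by
  by_contra! h
  obtain ⟨⟨x, hx, hfx⟩, y, hy, hfy⟩ := h
  obtain ⟨z, hz, hz0⟩ := isPreconnected_Ioo.intermediate_value hx hy hf ⟨hfx, hfy⟩
  exact h0 z hz hz0

/-- Between consecutive zeros of `M` and `M'`, the function `|M|` is strictly monotone and
`Φ(-|M|)` is, up to sign, a primitive of `φ(M) |M'|`. -/
lemma integral_phi_mul_abs_of_ne_zero {M M' : ℝ → ℝ} {c d : ℝ} (hcd : c < d)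
    (hM : ContinuousOn M (Icc c d)) (hderiv : ∀ t ∈ Ioo c d, HasDerivAt M (M' t) t)
    (hM' : ContinuousOn M' (Icc c d))
    (h0 : ∀ t ∈ Ioo c d, M t ≠ 0) (h0' : ∀ t ∈ Ioo c d, M' t ≠ 0) :
    (StrictMonoOn (fun t => |M t|) (Icc c d) ∧
      ∫ t in c..d, phi (M t) * |M' t| = Phi (-|M c|) - Phi (-|M d|)) ∨
    (StrictAntiOn (fun t => |M t|) (Icc c d) ∧
      ∫ t in c..d, phi (M t) * |M' t| = Phi (-|M d|) - Phi (-|M c|)) := by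
  have ftc : ∫ t in c..d, phi (M t) * M' t = Phi (M d) - Phi (M c) := by
    refine integral_eq_sub_of_hasDerivAt_of_le hcd.le
      (f := fun t => Phi (M t)) ?_ (fun t ht => (hasDerivAt_Phi _).comp t (hderiv t ht)) ?_
    · exact (continuous_iff_continuousAt.2 fun z =>
        (hasDerivAt_Phi z).continuousAt).comp_continuousOn hM
    · refine ContinuousOn.intervalIntegrable ?_
      rw [uIcc_of_le hcd.le]
      exact (continuous_phi.comp_continuousOn hM).mul hM'
  have congrI {f : ℝ → ℝ} (hf : ∀ t ∈ Ioo c d, phi (M t) * |M' t| = f t) :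
      ∫ t in c..d, phi (M t) * |M' t| = ∫ t in c..d, f t := by
    rw [integral_of_le hcd.le, integral_of_le hcd.le, integral_Ioc_eq_integral_Ioo,
      integral_Ioc_eq_integral_Ioo]
    exact setIntegral_congr_fun measurableSet_Ioo hf
  have hclos {p : ℝ → ℝ} (hp : ContinuousOn p (Icc c d)) (h : ∀ t ∈ Ioo c d, 0 < p t) :
      ∀ t ∈ Icc c d, 0 ≤ p t := by
    intro t ht
    have hmem : t ∈ closure (Ioo c d) := by rwa [closure_Ioo hcd.ne]
    have := (hp t ht).mono Ioo_subset_Icc_self |>.mem_closure hmem (t := Ici 0)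
      (fun y hy => (h y hy).le)
    simpa using this
  have hc := left_mem_Icc.2 hcd.le
  have hd := right_mem_Icc.2 hcd.le
  have hintegral_pos (h : ∀ t ∈ Ioo c d, 0 < M' t) :
      ∫ t in c..d, phi (M t) * |M' t| = Phi (M d) - Phi (M c) := by
    rw [← ftc]
    exact congrI fun t ht => by rw [abs_of_pos (h t ht)]
  have hintegral_neg (h : ∀ t ∈ Ioo c d, M' t < 0) :
      ∫ t in c..d, phi (M t) * |M' t| = Phi (M c) - Phi (M d) := by
    rw [← neg_sub, ← ftc, ← intervalIntegral.integral_neg]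
    exact congrI fun t ht => by rw [abs_of_neg (h t ht)]; ring
  have hmono (h : ∀ t ∈ Ioo c d, 0 < M' t) : StrictMonoOn M (Icc c d) :=
    strictMonoOn_of_deriv_pos (convex_Icc c d) hM fun t ht => by
      rw [interior_Icc] at ht
      rw [(hderiv t ht).deriv]
      exact h t ht
  have hanti (h : ∀ t ∈ Ioo c d, M' t < 0) : StrictAntiOn M (Icc c d) :=
    strictAntiOn_of_deriv_neg (convex_Icc c d) hM fun t ht => by
      rw [interior_Icc] at ht
      rw [(hderiv t ht).deriv]
      exact h t ht
  rcases (hM.mono Ioo_subset_Icc_self).forall_pos_or_forall_neg_Ioo h0 with hs | hs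
  · have hnn := hclos hM hs
    have habs : EqOn M (fun t => |M t|) (Icc c d) := fun t ht => (abs_of_nonneg (hnn t ht)).symm
    rw [abs_of_nonneg (hnn c hc), abs_of_nonneg (hnn d hd), Phi_neg, Phi_neg]
    rcases (hM'.mono Ioo_subset_Icc_self).forall_pos_or_forall_neg_Ioo h0' with hs' | hs'
    · exact Or.inl ⟨(hmono hs').congr habs, by rw [hintegral_pos hs']; ring⟩
    · exact Or.inr ⟨(hanti hs').congr habs, by rw [hintegral_neg hs']; ring⟩
  · have hnp := hclos hM.neg fun t ht => neg_pos.2 (hs t ht)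
    have habs : EqOn (fun t => -M t) (fun t => |M t|) (Icc c d) := fun t ht =>
      (abs_of_nonpos (neg_nonneg.1 (hnp t ht))).symm
    rw [abs_of_nonpos (neg_nonneg.1 (hnp c hc)), abs_of_nonpos (neg_nonneg.1 (hnp d hd)),
      neg_neg, neg_neg]
    rcases (hM'.mono Ioo_subset_Icc_self).forall_pos_or_forall_neg_Ioo h0' with hs' | hs'
    · exact Or.inr ⟨StrictAntiOn.congr (fun x hx y hy hxy => neg_lt_neg (hmono hs' hx hy hxy)) habs,
        hintegral_pos hs'⟩
    · exact Or.inl ⟨StrictMonoOn.congr (fun x hx y hy hxy => neg_lt_neg (hanti hs' hx hy hxy)) habs,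
        hintegral_neg hs'⟩

lemma exists_gt_forall_notMem_Ioo (S : Finset ℝ) {x b : ℝ} (hxb : x < b) :
    ∃ d, x < d ∧ d ≤ b ∧ ∀ y ∈ S, y ∉ Ioo x d := by
  have h : ∀ᶠ d in 𝓝[>] x, ∀ y ∈ S, y ∉ Ioo x d := by
    rw [Filter.eventually_all_finset]
    intro y _
    rcases le_or_gt y x with hy | hy
    · exact Eventually.of_forall fun d hd => hy.not_gt hd.1
    · filter_upwards [Ioo_mem_nhdsGT hy] with d hd hd' using lt_asymm hd.2 hd'.2
  obtain ⟨d, hd, hd'⟩ := (h.and (Ioo_mem_nhdsGT hxb)).exists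
  exact ⟨d, hd'.1, hd'.2.le, hd⟩

lemma exists_lt_forall_notMem_Ioo (S : Finset ℝ) {a x : ℝ} (hax : a < x) :
    ∃ c, c < x ∧ a ≤ c ∧ ∀ y ∈ S, y ∉ Ioo c x := by
  have h : ∀ᶠ c in 𝓝[<] x, ∀ y ∈ S, y ∉ Ioo c x := by
    rw [Filter.eventually_all_finset]
    intro y _
    rcases le_or_gt x y with hy | hy
    · exact Eventually.of_forall fun d hd => hy.not_gt hd.2
    · filter_upwards [Ioo_mem_nhdsLT hy] with d hd hd' using lt_asymm hd.1 hd'.1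
  obtain ⟨c, hc, hc'⟩ := (h.and (Ioo_mem_nhdsLT hax)).exists
  exact ⟨c, hc'.2, hc'.1.le, hc⟩

/-- `M : [0,T] → ℝ` is `C¹` with derivative `M'`, having finitely many
zeros, all interior and simple, and `M'` has finitely many zeros in `[0,T]`.
`Emax` is the (finite) set of locations of relative maxima of `|M|` on `[0,T]` and
`Emin` the set of locations of relative minima of `|M|` with nonzero value (the
endpoints `0, T` count as locations of relative extrema, which under these hypotheses
is captured by `IsLocalMaxOn`/`IsLocalMinOn` relative to `[0,T]`).  Weights are `1` at
the endpoints and `2` at interior extrema.  Then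
`∫_0^T φ(M(t))|M'(t)| dt = N_z^0 + Σ_min ν_j Φ(−m_j) − Σ_max ν̂_j Φ(−M_j)`. -/
theorem integral_phi_abs_deriv_eq
    (T : ℝ) (hT : 0 < T) (M M' : ℝ → ℝ)
    (hM : ∀ t ∈ Set.Icc (0 : ℝ) T, HasDerivWithinAt M (M' t) (Set.Icc 0 T) t)
    (hM'cont : ContinuousOn M' (Set.Icc 0 T))
    (hzfin : {t | t ∈ Set.Icc (0 : ℝ) T ∧ M t = 0}.Finite)
    (hzint : ∀ t ∈ Set.Icc (0 : ℝ) T, M t = 0 → t ∈ Set.Ioo (0 : ℝ) T)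
    (hzsimple : ∀ t ∈ Set.Icc (0 : ℝ) T, M t = 0 → M' t ≠ 0)
    (hcritfin : {t | t ∈ Set.Icc (0 : ℝ) T ∧ M' t = 0}.Finite)
    (Emax Emin : Finset ℝ)
    (hEmax : ∀ x, x ∈ Emax ↔
      (x ∈ Set.Icc (0 : ℝ) T ∧ IsLocalMaxOn (fun t => |M t|) (Set.Icc 0 T) x))
    (hEmin : ∀ x, x ∈ Emin ↔
      (x ∈ Set.Icc (0 : ℝ) T ∧ M x ≠ 0 ∧
        IsLocalMinOn (fun t => |M t|) (Set.Icc 0 T) x)) :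
    ∫ t in (0:ℝ)..T, phi (M t) * |M' t|
      = ({t | t ∈ Set.Icc (0 : ℝ) T ∧ M t = 0}.ncard : ℝ)
        + (∑ x ∈ Emin, (if x = 0 ∨ x = T then (1:ℝ) else 2) * Phi (-|M x|))
        - (∑ x ∈ Emax, (if x = 0 ∨ x = T then (1:ℝ) else 2) * Phi (-|M x|)) := by
  classical
  have hMc : ContinuousOn M (Icc 0 T) := fun t ht => (hM t ht).continuousWithinAt
  set g : ℝ → ℝ := fun t => |M t| with hg
  set S : Finset ℝ := hzfin.toFinset ∪ hcritfin.toFinset ∪ Emax ∪ Emin with hS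
  have hSIcc : ∀ x ∈ S, x ∈ Icc 0 T := by
    intro x hx
    simp only [hS, Finset.mem_union, Finite.mem_toFinset, mem_ofPred_eq, hEmax, hEmin] at hx
    tauto
  have hpiece : ∀ c d, 0 ≤ c → c < d → d ≤ T → (∀ x ∈ S, x ∉ Ioo c d) →
      (StrictMonoOn g (Icc c d) ∧
        ∫ t in c..d, phi (M t) * |M' t| = Phi (-|M c|) - Phi (-|M d|)) ∨
      (StrictAntiOn g (Icc c d) ∧
        ∫ t in c..d, phi (M t) * |M' t| = Phi (-|M d|) - Phi (-|M c|)) := by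
    intro c d hc hcd hd hfree
    have hsub : Icc c d ⊆ Icc 0 T := Icc_subset_Icc hc hd
    refine integral_phi_mul_abs_of_ne_zero hcd (hMc.mono hsub) (fun t ht => ?_)
      (hM'cont.mono hsub) (fun t ht h => hfree t ?_ ht) (fun t ht h => hfree t ?_ ht)
    · exact (hM t (hsub (Ioo_subset_Icc_self ht))).hasDerivAt
        (Icc_mem_nhds (hc.trans_lt ht.1) (ht.2.trans_le hd))
    · have := hsub (Ioo_subset_Icc_self ht)
      simp only [hS, Finset.mem_union, Finite.mem_toFinset, mem_ofPred_eq]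
      tauto
    · have := hsub (Ioo_subset_Icc_self ht)
      simp only [hS, Finset.mem_union, Finite.mem_toFinset, mem_ofPred_eq]
      tauto
  have hint : IntervalIntegrable (fun t => phi (M t) * |M' t|) volume 0 T := by
    refine ContinuousOn.intervalIntegrable ?_
    rw [uIcc_of_le hT.le]
    exact (continuous_phi.comp_continuousOn hMc).mul hM'cont.abs
  have key := integral_eq_boundary_add_sum_jumps (G := fun t => Phi (-|M t|))
    (l := leftSign g) (r := rightSign g) S hT hint (by
      intro c d hc hcd hd hfree
      rcases hpiece c d hc hcd hd hfree with ⟨h, hI⟩ | ⟨h, hI⟩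
      · rw [hI, rightSign_of_lt (h.eventually_nhdsGT_lt hcd),
          leftSign_of_lt (h.eventually_nhdsLT_lt hcd)]
        ring
      · rw [hI, rightSign_of_gt (h.eventually_nhdsGT_gt hcd),
          leftSign_of_gt (h.eventually_nhdsLT_gt hcd)]
        ring)
  have hR (x : ℝ) (hx : x ∈ Icc 0 T) (hxT : x < T) :
      (∀ᶠ y in 𝓝[>] x, g x < g y) ∨ ∀ᶠ y in 𝓝[>] x, g y < g x := by
    obtain ⟨d, hxd, hd, hfree⟩ := exists_gt_forall_notMem_Ioo S hxT
    exact (hpiece x d hx.1 hxd hd hfree).imp (fun h => h.1.eventually_nhdsGT_lt hxd)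
      (fun h => h.1.eventually_nhdsGT_gt hxd)
  have hL (x : ℝ) (hx : x ∈ Icc 0 T) (h0x : 0 < x) :
      (∀ᶠ y in 𝓝[<] x, g y < g x) ∨ ∀ᶠ y in 𝓝[<] x, g x < g y := by
    obtain ⟨c, hcx, hc, hfree⟩ := exists_lt_forall_notMem_Ioo S h0x
    exact (hpiece c x hc hcx hx.2 hfree).imp (fun h => h.1.eventually_nhdsLT_lt hcx)
      (fun h => h.1.eventually_nhdsLT_gt hcx)
  set K : Finset ℝ := insert 0 (insert T {x ∈ S | x ∈ Ioo 0 T}) with hK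
  have hKIcc : ∀ x ∈ K, x ∈ Icc 0 T := by
    intro x hx
    simp only [hK, Finset.mem_insert, Finset.mem_filter] at hx
    rcases hx with rfl | rfl | hx
    · exact left_mem_Icc.2 hT.le
    · exact right_mem_Icc.2 hT.le
    · exact Ioo_subset_Icc_self hx.2
  have hSK : S ⊆ K := by
    intro x hx
    simp only [hK, Finset.mem_insert, Finset.mem_filter]
    rcases (hSIcc x hx).1.eq_or_lt with h | h
    · exact Or.inl h.symm
    rcases (hSIcc x hx).2.eq_or_lt with h' | h'
    · exact Or.inr (Or.inl h')
    · exact Or.inr (Or.inr ⟨hx, h, h'⟩)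
  have hsumK : ∫ t in (0 : ℝ)..T, phi (M t) * |M' t|
      = ∑ x ∈ K, Phi (-|M x|) *
        ((if x = T then 0 else rightSign g x) - (if x = 0 then 0 else leftSign g x)) := by
    rw [key, hK, Finset.sum_insert (by simp [hT.ne]), Finset.sum_insert (by simp)]
    have : ∀ x ∈ ({x ∈ S | x ∈ Ioo 0 T} : Finset ℝ), Phi (-|M x|) *
        ((if x = T then 0 else rightSign g x) - (if x = 0 then 0 else leftSign g x))
        = Phi (-|M x|) * (rightSign g x - leftSign g x) := by
      intro x hx
      have hx' := (Finset.mem_filter.1 hx).2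
      rw [if_neg hx'.2.ne, if_neg hx'.1.ne']
    rw [Finset.sum_congr rfl this, if_neg hT.ne, if_pos rfl, if_pos rfl, if_neg hT.ne']
    ring
  have hpoint : ∀ x ∈ K, Phi (-|M x|) *
      ((if x = T then 0 else rightSign g x) - (if x = 0 then 0 else leftSign g x))
      = (if x ∈ hzfin.toFinset then (1 : ℝ) else 0)
        + (if x ∈ Emin then (if x = 0 ∨ x = T then (1:ℝ) else 2) * Phi (-|M x|) else 0)
        - (if x ∈ Emax then (if x = 0 ∨ x = T then (1:ℝ) else 2) * Phi (-|M x|) else 0) := by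
    intro x hxK
    have hx := hKIcc x hxK
    rw [sign_jump_eq_weight hT hx (hR x hx) (hL x hx)]
    by_cases hz : M x = 0
    · have hIoo := hzint x hx hz
      have hmin : IsLocalMinOn g (Icc 0 T) x :=
        Eventually.of_forall fun y => by simp [hg, hz]
      have hmax : ¬ IsLocalMaxOn g (Icc 0 T) x := by
        intro hm
        have hle : 𝓝[>] x ≤ 𝓝[Icc 0 T] x := by
          rw [← nhdsWithin_Ioo_eq_nhdsGT hIoo.2]
          exact nhdsWithin_mono _ fun y hy => ⟨hx.1.trans hy.1.le, hy.2.le⟩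
        have hmin' : ∀ᶠ y in 𝓝[>] x, g x ≤ g y := hmin.filter_mono hle
        have hmax' : ∀ᶠ y in 𝓝[>] x, g y ≤ g x := hm.filter_mono hle
        rcases hR x hx hIoo.2 with h | h
        · obtain ⟨y, h1, h2⟩ := (h.and hmax').exists
          exact h1.not_ge h2
        · obtain ⟨y, h1, h2⟩ := (h.and hmin').exists
          exact h1.not_ge h2
      have e1 : x ∈ hzfin.toFinset := by simpa using ⟨hx, hz⟩
      have e2 : x ∉ Emin := fun h => ((hEmin x).1 h).2.1 hz
      have e3 : x ∉ Emax := fun h => hmax ((hEmax x).1 h).2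
      rw [if_pos e1, if_neg e2, if_neg e3, if_pos hmin, if_neg hmax,
        if_neg (not_or.2 ⟨hIoo.1.ne', hIoo.2.ne⟩), hz, abs_zero, neg_zero, Phi_zero]
      norm_num
    · have e1 : x ∉ hzfin.toFinset := fun h => hz (by simpa using h : _ ∧ _).2
      have e2 : x ∈ Emin ↔ IsLocalMinOn g (Icc 0 T) x := by
        rw [hEmin]
        exact ⟨fun h => h.2.2, fun h => ⟨hx, hz, h⟩⟩
      have e3 : x ∈ Emax ↔ IsLocalMaxOn g (Icc 0 T) x := by
        rw [hEmax]
        exact ⟨fun h => h.2, fun h => ⟨hx, h⟩⟩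
      simp only [e1, e2, e3, if_false]
      split_ifs <;> ring
  have hsum {A : Finset ℝ} (hA : A ⊆ S) (f : ℝ → ℝ) :
      ∑ x ∈ K, (if x ∈ A then f x else 0) = ∑ x ∈ A, f x := by
    rw [Finset.sum_ite_mem, Finset.inter_eq_right.2 (hA.trans hSK)]
  rw [hsumK, Finset.sum_congr rfl hpoint, Finset.sum_sub_distrib, Finset.sum_add_distrib,
    hsum (by intro x hx; simp only [hS, Finset.mem_union]; tauto),
    hsum (by intro x hx; simp only [hS, Finset.mem_union]; tauto),
    hsum (by intro x hx; simp only [hS, Finset.mem_union]; tauto),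
    ncard_eq_toFinset_card _ hzfin]
  simp
end
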